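/- arXiv:2509.17518 — 3 statements merged into one kernel-verified Lean document; each statement's English description precedes it below -/
import Mathlib

section
/- Local central limit theorem for the long-range random walk, case 0 < α < 2 (Lemma LCLT): for every integer d ≥ 1, every real α with 0 < α < 2 and every t > 0, lim_{N→+∞} sup_{x ∈ Z^d} | N^{d/α} · p_{tN}^{d,α}(0,x) − f_t^{d,α}(x/N^{1/α}) | = 0, where the limit is taken as the real parameter N tends to +∞. -/
open MeasureTheory Filter Real Topology

/-- Euclidean (l²) norm of a vector in `Fin d → ℝ`. -/
noncomputable def l2norm {d : ℕ} (u : Fin d → ℝ) : ℝ := Real.sqrt (∑ i, u i ^ 2)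

/-- Euclidean norm of a lattice point. -/
noncomputable def zl2 {d : ℕ} (y : Fin d → ℤ) : ℝ := l2norm (fun i => (y i : ℝ))

/-- The symbol `Σ_{y ≠ 0} (cos(θ·y) − 1)/‖y‖₂^{d+α}` of the long-range random walk. -/
noncomputable def latticeSymbol (d : ℕ) (α : ℝ) (θ : Fin d → ℝ) : ℝ :=
  ∑' y : {y : Fin d → ℤ // y ≠ 0},
    (Real.cos (∑ i, θ i * (y.1 i : ℝ)) - 1) / zl2 y.1 ^ ((d : ℝ) + α)

/-- Transition probability `p_t^{d,α}(0,x)` of the long-range random walk, defined through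
the Fourier inversion formula. -/
noncomputable def pTrans (d : ℕ) (α : ℝ) (t : ℝ) (x : Fin d → ℤ) : ℝ :=
  ((2 * Real.pi) ^ d)⁻¹ *
    ∫ θ in Set.univ.pi (fun _ : Fin d => Set.Icc (-Real.pi) Real.pi),
      Real.exp (t * latticeSymbol d α θ) * Real.cos (∑ i, (x i : ℝ) * θ i)

/-- The constant `G̃^{d,α} = ∫_{R^d} (1 − cos v₁)/‖v‖₂^{d+α} dv`. -/
noncomputable def Gtilde (d : ℕ) (α : ℝ) : ℝ :=
  ∫ v : Fin d → ℝ, (1 - Real.cos (if h : 0 < d then v ⟨0, h⟩ else 0)) / l2norm v ^ ((d : ℝ) + α)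

/-- The density `f_t^{d,α}` of the limiting stable law (case `0 < α < 2`). -/
noncomputable def fDensity (d : ℕ) (α : ℝ) (t : ℝ) (u : Fin d → ℝ) : ℝ :=
  ((2 * Real.pi) ^ d)⁻¹ *
    ∫ θ : Fin d → ℝ, Real.cos (∑ i, θ i * u i) * Real.exp (-(t * l2norm θ ^ α * Gtilde d α))

/-- The summand of the lattice symbol, as a function on all of `ℝ^d`. -/
noncomputable def symbolKernel {d : ℕ} (α : ℝ) (v w : Fin d → ℝ) : ℝ :=
  (Real.cos (∑ i, v i * w i) - 1) / l2norm w ^ ((d : ℝ) + α)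

/-- A radial function dominating `symbolKernel α v` up to a constant depending on `v`. -/
noncomputable def kernelEnvelope {d : ℕ} (α : ℝ) (w : Fin d → ℝ) : ℝ :=
  min 1 (‖w‖ ^ 2) / ‖w‖ ^ ((d : ℝ) + α)

/-- The inclusion of `ℤ^d` into `ℝ^d`. -/
def latticeCoe {d : ℕ} (y : Fin d → ℤ) : Fin d → ℝ := fun i => (y i : ℝ)

/-- Rounding to the nearest lattice point, coordinatewise. -/
noncomputable def latticeRound {d : ℕ} (u : Fin d → ℝ) : Fin d → ℤ := fun i => round (u i)

theorem l2norm_nonneg {d : ℕ} (w : Fin d → ℝ) : 0 ≤ l2norm w := Real.sqrt_nonneg _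

theorem l2norm_eq_norm_toLp {d : ℕ} (w : Fin d → ℝ) : l2norm w = ‖WithLp.toLp 2 w‖ := by
  simp [l2norm, EuclideanSpace.norm_eq]

theorem continuous_l2norm {d : ℕ} : Continuous (l2norm : (Fin d → ℝ) → ℝ) := by
  unfold l2norm; fun_prop

theorem l2norm_smul {d : ℕ} (c : ℝ) (w : Fin d → ℝ) : l2norm (c • w) = |c| * l2norm w := by
  simp [l2norm_eq_norm_toLp, norm_smul]

theorem norm_le_l2norm {d : ℕ} (w : Fin d → ℝ) : ‖w‖ ≤ l2norm w := by
  refine (pi_norm_le_iff_of_nonneg (l2norm_nonneg w)).2 fun i => ?_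
  refine Real.abs_le_sqrt ?_
  exact Finset.single_le_sum (f := fun i => w i ^ 2) (fun _ _ => sq_nonneg _) (Finset.mem_univ i)

theorem l2norm_le_mul_norm {d : ℕ} (w : Fin d → ℝ) : l2norm w ≤ √d * ‖w‖ := by
  refine (Real.sqrt_le_sqrt (?_ : _ ≤ d * ‖w‖ ^ 2)).trans_eq ?_
  · refine (Finset.sum_le_card_nsmul _ _ (‖w‖ ^ 2) fun i _ => ?_).trans_eq (by simp)
    exact sq_le_sq' (neg_le_of_abs_le (norm_le_pi_norm w i)) (le_of_abs_le (norm_le_pi_norm w i))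
  · rw [Real.sqrt_mul (Nat.cast_nonneg d), Real.sqrt_sq (norm_nonneg w)]

theorem l2norm_pos {d : ℕ} {w : Fin d → ℝ} (hw : w ≠ 0) : 0 < l2norm w :=
  (norm_pos_iff.2 hw).trans_le (norm_le_l2norm w)

theorem kernelEnvelope_nonneg {d : ℕ} (α : ℝ) (w : Fin d → ℝ) : 0 ≤ kernelEnvelope α w := by
  unfold kernelEnvelope; positivity

theorem symbolKernel_nonpos {d : ℕ} (α : ℝ) (v w : Fin d → ℝ) : symbolKernel α v w ≤ 0 :=
  div_nonpos_of_nonpos_of_nonneg (by linarith [Real.cos_le_one (∑ i, v i * w i)])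
    (Real.rpow_nonneg (l2norm_nonneg w) _)

theorem abs_symbolKernel_le {d : ℕ} {α : ℝ} (hα : 0 < α) (v w : Fin d → ℝ) :
    |symbolKernel α v w| ≤ (2 + (∑ i, |v i|) ^ 2) * kernelEnvelope α w := by
  rcases eq_or_ne w 0 with rfl | hw
  · simpa [symbolKernel] using mul_nonneg (by positivity) (kernelEnvelope_nonneg α _)
  have hw' := norm_pos_iff.2 hw
  set s := ∑ i, v i * w i with hs
  have hsw : |s| ≤ (∑ i, |v i|) * ‖w‖ := by
    rw [hs, Finset.sum_mul]
    refine (Finset.abs_sum_le_sum_abs _ _).trans (Finset.sum_le_sum fun i _ => ?_)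
    rw [abs_mul]
    exact mul_le_mul_of_nonneg_left (norm_le_pi_norm w i) (abs_nonneg _)
  have hnum : |Real.cos s - 1| ≤ (2 + (∑ i, |v i|) ^ 2) * min 1 (‖w‖ ^ 2) := by
    rw [abs_of_nonpos (by linarith [Real.cos_le_one s])]
    rcases min_choice 1 (‖w‖ ^ 2) with h | h <;> rw [h]
    · nlinarith [Real.neg_one_le_cos s, sq_nonneg (∑ i, |v i|)]
    · have h1 := Real.one_sub_sq_div_two_le_cos (x := s)
      have h2 : s ^ 2 ≤ ((∑ i, |v i|) * ‖w‖) ^ 2 := sq_le_sq' (neg_le_of_abs_le hsw)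
        (le_of_abs_le hsw)
      nlinarith [sq_nonneg ‖w‖, sq_nonneg ((∑ i, |v i|) * ‖w‖)]
  rw [symbolKernel, kernelEnvelope, abs_div, ← mul_div_assoc,
    abs_of_nonneg (Real.rpow_nonneg (l2norm_nonneg w) _)]
  refine div_le_div₀ (by positivity) hnum (by positivity) ?_
  exact Real.rpow_le_rpow hw'.le (norm_le_l2norm w) (by positivity)

theorem integrable_comp_norm {d : ℕ} (hd : 1 ≤ d) {f : ℝ → ℝ}
    (hf : IntegrableOn (fun r : ℝ => r ^ (d - 1) * f r) (Set.Ioi 0)) :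
    Integrable fun w : Fin d → ℝ => f ‖w‖ := by
  have : Nonempty (Fin d) := ⟨⟨0, hd⟩⟩
  rw [integrable_fun_norm_addHaar]
  simpa using hf

theorem integrable_kernelEnvelope {d : ℕ} (hd : 1 ≤ d) {α : ℝ} (hα0 : 0 < α) (hα2 : α < 2) :
    Integrable (kernelEnvelope α : (Fin d → ℝ) → ℝ) := by
  refine integrable_comp_norm hd (f := fun r => min 1 (r ^ 2) / r ^ ((d : ℝ) + α)) ?_
  have hpow : ∀ r : ℝ, 0 < r → r ^ (d - 1) = r ^ ((d : ℝ) - 1) := fun r hr => by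
    rw [← Real.rpow_natCast, Nat.cast_sub hd, Nat.cast_one]
  rw [← Set.Ioc_union_Ioi_eq_Ioi zero_le_one]
  refine IntegrableOn.union ?_ ?_
  · have h : IntegrableOn (fun r : ℝ => r ^ (1 - α)) (Set.Ioc 0 1) :=
      (intervalIntegrable_iff_integrableOn_Ioc_of_le zero_le_one).1
        (intervalIntegral.intervalIntegrable_rpow' (by linarith))
    refine h.congr_fun (fun r hr => ?_) measurableSet_Ioc
    have h1 : min 1 (r ^ 2) = r ^ (2 : ℝ) := by
      rw [min_eq_right (pow_le_one₀ hr.1.le hr.2), ← Real.rpow_natCast]; norm_num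
    simp only [h1, hpow r hr.1]
    rw [← mul_div_assoc, ← Real.rpow_add hr.1, ← Real.rpow_sub hr.1]
    ring_nf
  · have h := integrableOn_Ioi_rpow_of_lt (a := -1 - α) (by linarith) zero_lt_one
    refine h.congr_fun (fun r hr => ?_) measurableSet_Ioi
    have hr' : (1 : ℝ) < r := hr
    have hr0 : 0 < r := by linarith
    have h1 : min 1 (r ^ 2) = 1 := min_eq_left (one_le_pow₀ hr'.le)
    simp only [h1, hpow r hr0]
    rw [← mul_div_assoc, mul_one, ← Real.rpow_sub hr0]
    ring_nf

theorem integrable_exp_neg_norm_rpow {d : ℕ} (hd : 1 ≤ d) {α c : ℝ} (hα : 0 < α) (hc : 0 < c) :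
    Integrable fun w : Fin d → ℝ => Real.exp (-c * ‖w‖ ^ α) := by
  refine integrable_comp_norm hd (f := fun r => Real.exp (-c * r ^ α)) ?_
  have hd' : (0 : ℝ) < d := by exact_mod_cast hd
  have h := integral_rpow_mul_exp_neg_mul_rpow (p := α) (q := (d : ℝ) - 1) (b := c) hα
    (by linarith) hc
  have hint : IntegrableOn (fun r : ℝ => r ^ ((d : ℝ) - 1) * Real.exp (-c * r ^ α))
      (Set.Ioi 0) := by
    refine Integrable.of_integral_ne_zero ?_
    rw [h]
    have := Real.Gamma_pos_of_pos (s := ((d : ℝ) - 1 + 1) / α) (div_pos (by linarith) hα)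
    positivity
  refine hint.congr_fun (fun r hr => ?_) measurableSet_Ioi
  simp only
  rw [← Real.rpow_natCast, Nat.cast_sub hd, Nat.cast_one]

theorem norm_sub_latticeRound_le {d : ℕ} {h : ℝ} (hh : 0 < h) (u : Fin d → ℝ) :
    ‖u - h • latticeCoe (latticeRound (h⁻¹ • u))‖ ≤ h / 2 := by
  refine (pi_norm_le_iff_of_nonneg (by positivity)).2 fun i => ?_
  have h1 := abs_sub_round (h⁻¹ * u i)
  have h2 : u i - h * round (h⁻¹ * u i) = h * (h⁻¹ * u i - round (h⁻¹ * u i)) := by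
    field_simp
  simp only [Pi.sub_apply, Pi.smul_apply, latticeCoe, latticeRound, smul_eq_mul, Real.norm_eq_abs]
  rw [h2, abs_mul, abs_of_pos hh]
  nlinarith

theorem one_le_norm_latticeCoe {d : ℕ} {y : Fin d → ℤ} (hy : y ≠ 0) : 1 ≤ ‖latticeCoe y‖ := by
  obtain ⟨i, hi⟩ := Function.ne_iff.1 hy
  refine le_trans ?_ (norm_le_pi_norm (latticeCoe y) i)
  simpa [latticeCoe] using (by exact_mod_cast Int.one_le_abs hi : (1 : ℝ) ≤ |(y i : ℝ)|)

theorem latticeCoe_zero {d : ℕ} : latticeCoe (0 : Fin d → ℤ) = 0 := by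
  ext; simp [latticeCoe]

theorem kernelEnvelope_smul_latticeRound_le {d : ℕ} {α : ℝ} (hα : 0 < α) {h : ℝ} (hh : 0 < h)
    (u : Fin d → ℝ) :
    kernelEnvelope α (h • latticeCoe (latticeRound (h⁻¹ • u))) ≤
      4 * (3 / 2) ^ ((d : ℝ) + α) * kernelEnvelope α u := by
  have h1 := norm_sub_latticeRound_le hh u
  by_cases hy : latticeRound (h⁻¹ • u) = 0
  · rw [hy, latticeCoe_zero, smul_zero]
    have := kernelEnvelope_nonneg α u
    simpa [kernelEnvelope] using mul_nonneg (by positivity) this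
  have h2 := one_le_norm_latticeCoe hy
  set w := h • latticeCoe (latticeRound (h⁻¹ • u)) with hw
  have h3 : h ≤ ‖w‖ := by
    rw [hw, norm_smul, Real.norm_of_nonneg hh.le]; nlinarith
  have h4 : ‖u‖ ≤ 3 / 2 * ‖w‖ := by
    have := norm_add_le (u - w) w
    rw [sub_add_cancel] at this; linarith
  have h5 : ‖w‖ ≤ 2 * ‖u‖ := by
    have := norm_sub_le u (u - w)
    rw [sub_sub_cancel] at this; linarith
  have hu : 0 < ‖u‖ := by linarith
  have hwp : 0 < ‖w‖ := by linarith
  have h6 : ‖u‖ ^ ((d : ℝ) + α) ≤ (3 / 2) ^ ((d : ℝ) + α) * ‖w‖ ^ ((d : ℝ) + α) := by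
    rw [← Real.mul_rpow (by norm_num) hwp.le]
    exact Real.rpow_le_rpow hu.le h4 (by positivity)
  have h7 : min 1 (‖w‖ ^ 2) ≤ 4 * min 1 (‖u‖ ^ 2) := by
    rcases min_choice 1 (‖u‖ ^ 2) with h | h <;> rw [h]
    · exact (min_le_left _ _).trans (by norm_num)
    · exact (min_le_right _ _).trans (by nlinarith)
  unfold kernelEnvelope
  rw [div_le_iff₀ (by positivity), ← mul_div_assoc, div_mul_eq_mul_div, le_div_iff₀ (by positivity)]
  calc min 1 (‖w‖ ^ 2) * ‖u‖ ^ ((d : ℝ) + α)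
      ≤ (4 * min 1 (‖u‖ ^ 2)) * ((3 / 2) ^ ((d : ℝ) + α) * ‖w‖ ^ ((d : ℝ) + α)) := by gcongr
    _ = _ := by ring

theorem measurable_latticeRound {d : ℕ} :
    Measurable (latticeRound : (Fin d → ℝ) → Fin d → ℤ) := by
  refine measurable_pi_lambda _ fun i => ?_
  simp only [latticeRound, round_eq]
  exact Int.measurable_floor.comp (by fun_prop)

theorem measurePreserving_latticeRound {d : ℕ} :
    MeasurePreserving (latticeRound : (Fin d → ℝ) → Fin d → ℤ) volume Measure.count := by
  refine ⟨measurable_latticeRound, Measure.ext_of_singleton fun y => ?_⟩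
  rw [Measure.map_apply measurable_latticeRound (measurableSet_singleton y),
    Measure.count_singleton]
  have : latticeRound ⁻¹' {y} =
      Set.univ.pi fun i => Set.Ico ((y i : ℝ) - 1 / 2) ((y i : ℝ) + 1 / 2) := by
    ext u
    simp only [Set.mem_preimage, Set.mem_singleton_iff, Set.mem_univ_pi, ← round_eq_iff]
    exact funext_iff
  rw [this, volume_pi_pi]
  refine Finset.prod_eq_one fun i _ => ?_
  rw [Real.volume_Ico]
  norm_num

theorem summable_kernelEnvelope {d : ℕ} (hd : 1 ≤ d) {α : ℝ} (hα0 : 0 < α) (hα2 : α < 2) :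
    Summable fun y : Fin d → ℤ => kernelEnvelope α (latticeCoe y) := by
  have hm : Integrable (fun y : Fin d → ℤ => kernelEnvelope α (latticeCoe y)) Measure.count := by
    refine (measurePreserving_latticeRound.integrable_comp
      (measurable_of_countable _).aestronglyMeasurable).1 ?_
    refine ((integrable_kernelEnvelope hd hα0 hα2).const_mul
      (4 * (3 / 2) ^ ((d : ℝ) + α))).mono' ?_ (ae_of_all _ fun u => ?_)
    · exact ((measurable_of_countable _).comp measurable_latticeRound).aestronglyMeasurable
    · rw [Function.comp_apply, Real.norm_of_nonneg (kernelEnvelope_nonneg _ _)]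
      simpa using kernelEnvelope_smul_latticeRound_le hα0 one_pos u
  exact (integrable_count_iff.1 hm).of_norm

theorem summable_symbolKernel {d : ℕ} (hd : 1 ≤ d) {α : ℝ} (hα0 : 0 < α) (hα2 : α < 2)
    (θ : Fin d → ℝ) : Summable fun y : Fin d → ℤ => symbolKernel α θ (latticeCoe y) :=
  .of_norm_bounded ((summable_kernelEnvelope hd hα0 hα2).mul_left _)
    fun _ => abs_symbolKernel_le hα0 _ _

theorem latticeSymbol_eq_tsum {d : ℕ} (α : ℝ) (θ : Fin d → ℝ) :
    latticeSymbol d α θ = ∑' y : Fin d → ℤ, symbolKernel α θ (latticeCoe y) := by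
  refine tsum_subtype_eq_of_support_subset (s := {y : Fin d → ℤ | y ≠ 0})
    (f := fun y => symbolKernel α θ (latticeCoe y)) fun y hy => ?_
  rintro rfl
  simp [latticeCoe_zero, symbolKernel] at hy

theorem continuous_latticeSymbol {d : ℕ} (hd : 1 ≤ d) {α : ℝ} (hα0 : 0 < α) (hα2 : α < 2) :
    Continuous (latticeSymbol d α) := by
  simp_rw [funext (latticeSymbol_eq_tsum (d := d) α)]
  refine continuous_tsum (fun y => ?_) ((summable_kernelEnvelope hd hα0 hα2).mul_left 2)
    fun y θ => ?_
  · unfold symbolKernel; fun_prop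
  · rcases eq_or_ne y 0 with rfl | hy
    · simp [latticeCoe_zero, symbolKernel, kernelEnvelope]
    have h1 := one_le_norm_latticeCoe hy
    have h2 := norm_le_l2norm (latticeCoe y)
    rw [kernelEnvelope, min_eq_left (one_le_pow₀ h1), symbolKernel, norm_div,
      Real.norm_of_nonneg (Real.rpow_nonneg (l2norm_nonneg _) _), ← mul_div_assoc, mul_one]
    refine div_le_div₀ (by norm_num) ?_ (by positivity) (Real.rpow_le_rpow (by positivity) h2
      (by positivity))
    rw [Real.norm_eq_abs, abs_le]
    constructor <;> linarith [Real.cos_le_one (∑ i, θ i * latticeCoe y i),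
      Real.neg_one_le_cos (∑ i, θ i * latticeCoe y i)]

theorem symbolKernel_smul_left {d : ℕ} (α : ℝ) {h : ℝ} (hh : 0 < h) (v w : Fin d → ℝ) :
    symbolKernel α (h • v) w = h ^ ((d : ℝ) + α) * symbolKernel α v (h • w) := by
  have h1 : ∑ i, (h • v) i * w i = ∑ i, v i * (h • w) i :=
    Finset.sum_congr rfl fun i _ => by simp; ring
  rw [symbolKernel, symbolKernel, h1, l2norm_smul, abs_of_pos hh,
    Real.mul_rpow hh.le (l2norm_nonneg w), ← mul_div_assoc,
    mul_div_mul_left _ _ (Real.rpow_pos_of_pos hh _).ne']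

theorem latticeSymbol_smul {d : ℕ} (hd : 1 ≤ d) {α : ℝ} (hα0 : 0 < α) (hα2 : α < 2) {h : ℝ}
    (hh : 0 < h) (v : Fin d → ℝ) :
    latticeSymbol d α (h • v) =
      h ^ α * ∫ u, symbolKernel α v (h • latticeCoe (latticeRound (h⁻¹ • u))) := by
  have hsum := summable_symbolKernel hd hα0 hα2 (h • v)
  have h1 : latticeSymbol d α (h • v) =
      ∫ u, symbolKernel α (h • v) (latticeCoe (latticeRound u)) := by
    rw [latticeSymbol_eq_tsum]
    have h2 := integral_countable (integrable_count_iff.2 hsum.norm)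
    simp only [measureReal_def, Measure.count_singleton, ENNReal.toReal_one, one_smul] at h2
    rw [← h2, ← measurePreserving_latticeRound.map_eq, integral_map
      measurable_latticeRound.aemeasurable (measurable_of_countable _).aestronglyMeasurable]
  rw [h1]
  simp_rw [symbolKernel_smul_left α hh]
  rw [integral_const_mul, Measure.integral_comp_inv_smul_of_nonneg volume
    (fun u => symbolKernel α v (h • latticeCoe (latticeRound u))) hh.le, Real.rpow_add hh]
  simp
  ring

theorem tendsto_smul_latticeRound {d : ℕ} (u : Fin d → ℝ) :
    Tendsto (fun h : ℝ => h • latticeCoe (latticeRound (h⁻¹ • u))) (𝓝[>] 0) (𝓝 u) := by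
  rw [tendsto_iff_norm_sub_tendsto_zero]
  have h0 : Tendsto (fun h : ℝ => h / 2) (𝓝[>] 0) (𝓝 0) :=
    tendsto_nhdsWithin_of_tendsto_nhds (by simpa using (continuous_id.div_const (2 : ℝ)).tendsto 0)
  refine squeeze_zero' (Eventually.of_forall fun _ => norm_nonneg _) ?_ h0
  filter_upwards [self_mem_nhdsWithin] with h hh
  rw [norm_sub_rev]
  exact norm_sub_latticeRound_le hh u

theorem continuousAt_symbolKernel {d : ℕ} (α : ℝ) (v : Fin d → ℝ) {u : Fin d → ℝ} (hu : u ≠ 0) :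
    ContinuousAt (symbolKernel α v) u := by
  have h := l2norm_pos hu
  have hnum : Continuous fun w : Fin d → ℝ => Real.cos (∑ i, v i * w i) - 1 := by fun_prop
  refine hnum.continuousAt.div ?_ (Real.rpow_pos_of_pos h _).ne'
  exact continuous_l2norm.continuousAt.rpow_const (Or.inl h.ne')

theorem tendsto_integral_symbolKernel {d : ℕ} (hd : 1 ≤ d) {α : ℝ} (hα0 : 0 < α) (hα2 : α < 2)
    (v : Fin d → ℝ) :
    Tendsto (fun h : ℝ => ∫ u, symbolKernel α v (h • latticeCoe (latticeRound (h⁻¹ • u))))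
      (𝓝[>] 0) (𝓝 (∫ u, symbolKernel α v u)) := by
  have : Nonempty (Fin d) := ⟨⟨0, hd⟩⟩
  refine tendsto_integral_filter_of_dominated_convergence
    (fun u => (2 + (∑ i, |v i|) ^ 2) * (4 * (3 / 2) ^ ((d : ℝ) + α) * kernelEnvelope α u))
    (Eventually.of_forall fun h => ?_) ?_
    (((integrable_kernelEnvelope hd hα0 hα2).const_mul _).const_mul _) ?_
  · refine Measurable.aestronglyMeasurable ?_
    have h1 : Measurable fun y : Fin d → ℤ => symbolKernel α v (h • latticeCoe y) :=
      measurable_of_countable _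
    exact h1.comp (measurable_latticeRound.comp (measurable_const_smul h⁻¹))
  · filter_upwards [self_mem_nhdsWithin] with h hh
    refine ae_of_all _ fun u => (abs_symbolKernel_le hα0 _ _).trans ?_
    exact mul_le_mul_of_nonneg_left (kernelEnvelope_smul_latticeRound_le hα0 hh u) (by positivity)
  · filter_upwards [compl_mem_ae_iff.2 (measure_singleton (0 : Fin d → ℝ))] with u hu
    exact (continuousAt_symbolKernel α v hu).tendsto.comp (tendsto_smul_latticeRound u)

/-- A measure-preserving rotation of `ℝ^d` sending the direction of `v` to the first axis. -/
theorem exists_measurePreserving_rotation {d : ℕ} (hd : 0 < d) {v : Fin d → ℝ} (hv : v ≠ 0) :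
    ∃ M : (Fin d → ℝ) ≃ᵐ (Fin d → ℝ), MeasurePreserving M ∧ (∀ u, l2norm (M u) = l2norm u) ∧
      ∀ u, l2norm v * M u ⟨0, hd⟩ = ∑ i, v i * u i := by
  set r := l2norm v with hr
  have hr0 : 0 < r := l2norm_pos hv
  set V : EuclideanSpace ℝ (Fin d) := WithLp.toLp 2 v with hV
  set e : EuclideanSpace ℝ (Fin d) := EuclideanSpace.single ⟨0, hd⟩ 1 with he
  have hnorm : ‖r⁻¹ • V‖ = ‖e‖ := by
    rw [norm_smul, ← l2norm_eq_norm_toLp, ← hr, Real.norm_of_nonneg (inv_nonneg.2 hr0.le),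
      inv_mul_cancel₀ hr0.ne', he]
    simp
  set R : EuclideanSpace ℝ (Fin d) ≃ₗᵢ[ℝ] EuclideanSpace ℝ (Fin d) :=
    (Submodule.span ℝ {r⁻¹ • V - e})ᗮ.reflection with hR
  have hRe : R (r⁻¹ • V) = e := Submodule.reflection_sub hnorm
  let T := MeasurableEquiv.toLp 2 (Fin d → ℝ)
  refine ⟨(T.trans R.toHomeomorph.toMeasurableEquiv).trans T.symm, ?_, fun u => ?_, fun u => ?_⟩
  · exact ((PiLp.volume_preserving_toLp (Fin d)).trans R.measurePreserving).trans
      (PiLp.volume_preserving_ofLp (Fin d))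
  · rw [l2norm_eq_norm_toLp, l2norm_eq_norm_toLp]
    exact R.norm_map _
  · have h1 : inner ℝ V (WithLp.toLp 2 u) = ∑ i, v i * u i := by
      simp [PiLp.inner_apply, hV, mul_comm]
    have h2 : inner ℝ e (R (WithLp.toLp 2 u)) = R (WithLp.toLp 2 u) ⟨0, hd⟩ := by
      simp [he, EuclideanSpace.inner_single_left]
    rw [← h1, show V = r • (r⁻¹ • V) by rw [smul_smul, mul_inv_cancel₀ hr0.ne', one_smul],
      real_inner_smul_left, ← R.inner_map_map, hRe, h2]
    rfl

theorem integral_symbolKernel {d : ℕ} (hd : 1 ≤ d) (α : ℝ) {v : Fin d → ℝ} (hv : v ≠ 0) :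
    ∫ u, symbolKernel α v u = -(l2norm v ^ α * Gtilde d α) := by
  obtain ⟨M, hM, hnorm, hcoord⟩ := exists_measurePreserving_rotation hd hv
  set r := l2norm v with hr
  have hr0 : 0 < r := l2norm_pos hv
  set Φ : (Fin d → ℝ) → ℝ := fun w =>
    (1 - Real.cos (if h : 0 < d then w ⟨0, h⟩ else 0)) / l2norm w ^ ((d : ℝ) + α) with hΦ
  have key : ∀ u, symbolKernel α v u = -(r ^ ((d : ℝ) + α) * Φ (r • M u)) := fun u => by
    simp only [hΦ, dif_pos (show 0 < d from hd), symbolKernel, Pi.smul_apply, smul_eq_mul, hcoord,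
      l2norm_smul, abs_of_pos hr0, hnorm]
    rw [Real.mul_rpow hr0.le (l2norm_nonneg u), ← mul_div_assoc,
      mul_div_mul_left _ _ (Real.rpow_pos_of_pos hr0 _).ne', ← neg_div, neg_sub]
  simp_rw [key]
  rw [integral_neg, integral_const_mul, hM.integral_comp' (fun u => Φ (r • u)),
    Measure.integral_comp_smul_of_nonneg volume Φ r (hR := hr0.le), Real.rpow_add hr0,
    show Gtilde d α = ∫ w, Φ w from rfl]
  simp only [Module.finrank_fintype_fun_eq_card, Fintype.card_fin, smul_eq_mul,
    Real.rpow_natCast]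
  field_simp

theorem cos_add_cos_add_le {a b : ℝ} (hb1 : π / 2 ≤ |b|) (hb2 : |b| ≤ π) :
    Real.cos a + Real.cos (a + b) ≤ 3 / 2 := by
  have h1 : Real.cos (b / 2) = Real.cos (|b| / 2) := by
    rw [← Real.cos_abs, abs_div, abs_two]
  have h2 : Real.cos (|b| / 2) ≤ √2 / 2 := by
    rw [← Real.cos_pi_div_four]
    exact Real.cos_le_cos_of_nonneg_of_le_pi (by positivity) (by linarith [Real.pi_pos])
      (by linarith)
  have h3 : 0 ≤ Real.cos (|b| / 2) :=
    Real.cos_nonneg_of_mem_Icc ⟨by linarith [Real.pi_pos], by linarith⟩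
  have h4 : Real.cos a + Real.cos (a + b) = 2 * Real.cos (a + b / 2) * Real.cos (b / 2) := by
    rw [add_comm (Real.cos a), Real.cos_add_cos]
    congr 2 <;> ring_nf
  have h5 : √2 ≤ 3 / 2 := Real.sqrt_le_iff.2 (by norm_num)
  rw [h4, h1]
  nlinarith [Real.cos_le_one (a + b / 2)]

theorem one_sub_cos_div_le_neg_symbolKernel {d : ℕ} {α : ℝ} (hα : 0 < α) (θ : Fin d → ℝ)
    {y : Fin d → ℤ} {ρ : ℝ} (hy : ‖latticeCoe y‖ ≤ ρ) :
    (1 - Real.cos (∑ i, θ i * latticeCoe y i)) / (√d * ρ) ^ ((d : ℝ) + α) ≤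
      -symbolKernel α θ (latticeCoe y) := by
  rcases eq_or_ne y 0 with rfl | hy0
  · simp [latticeCoe_zero, symbolKernel]
  have h1 := one_le_norm_latticeCoe hy0
  have h2 : 0 < l2norm (latticeCoe y) :=
    (zero_lt_one.trans_le h1).trans_le (norm_le_l2norm _)
  rw [symbolKernel, ← neg_div, neg_sub]
  refine div_le_div_of_nonneg_left (by linarith [Real.cos_le_one (∑ i, θ i * latticeCoe y i)])
    (by positivity) (Real.rpow_le_rpow h2.le ?_ (by positivity))
  exact (l2norm_le_mul_norm _).trans (mul_le_mul_of_nonneg_left hy (Real.sqrt_nonneg _))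

theorem exists_abs_apply_eq_norm {d : ℕ} (hd : 1 ≤ d) (θ : Fin d → ℝ) : ∃ i, |θ i| = ‖θ‖ := by
  obtain ⟨i, -, hi⟩ := Finset.exists_max_image Finset.univ (fun i => |θ i|) ⟨⟨0, hd⟩, by simp⟩
  exact ⟨i, le_antisymm (norm_le_pi_norm θ i)
    ((pi_norm_le_iff_of_nonneg (abs_nonneg _)).2 fun j => hi j (Finset.mem_univ j))⟩

theorem exists_nat_mul_mem_Icc {h : ℝ} (h0 : 0 < h) (hπ : h ≤ π) :
    ∃ m : ℕ, 1 ≤ m ∧ π / 2 ≤ m * h ∧ m * h ≤ π := by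
  have hx : 1 ≤ π / h := (one_le_div h0).2 hπ
  have h1 : 1 ≤ ⌊π / h⌋₊ := Nat.one_le_floor_iff _ |>.2 hx
  have h1' : (1 : ℝ) ≤ ⌊π / h⌋₊ := by exact_mod_cast h1
  refine ⟨⌊π / h⌋₊, h1, ?_, (le_div_iff₀ h0).1 (Nat.floor_le (by positivity))⟩
  have h2 := (div_lt_iff₀ h0).1 (Nat.lt_floor_add_one (π / h))
  nlinarith

/-- The symbol is at most `-c ‖θ‖^α` on the Brillouin zone: shifting by a suitable multiple of a
coordinate vector, at least one of `y` and its shift contributes substantially. -/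
theorem exists_latticeSymbol_le {d : ℕ} (hd : 1 ≤ d) {α : ℝ} (hα0 : 0 < α) (hα2 : α < 2) :
    ∃ c > 0, ∀ θ : Fin d → ℝ, ‖θ‖ ≤ π → latticeSymbol d α θ ≤ -(c * ‖θ‖ ^ α) := by
  have hd' : (0 : ℝ) < d := by exact_mod_cast hd
  have hsd : 0 < √(d : ℝ) := Real.sqrt_pos.2 hd'
  refine ⟨(4 * ((√d * 2) ^ ((d : ℝ) + α) * π ^ α))⁻¹, by positivity, fun θ hθ => ?_⟩
  rw [latticeSymbol_eq_tsum]
  rcases eq_or_ne θ 0 with rfl | hθ0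
  · rw [norm_zero, Real.zero_rpow hα0.ne', mul_zero, neg_zero]
    exact tsum_nonpos fun y => symbolKernel_nonpos _ _ _
  have hn := norm_pos_iff.2 hθ0
  obtain ⟨i, hi⟩ := exists_abs_apply_eq_norm hd θ
  obtain ⟨m, hm1, hml, hmu⟩ := exists_nat_mul_mem_Icc hn hθ
  have hm0 : (0 : ℝ) < m := by exact_mod_cast hm1
  set f : (Fin d → ℤ) → ℝ := fun y => -symbolKernel α θ (latticeCoe y) with hf
  have hf0 : ∀ y, 0 ≤ f y := fun y => neg_nonneg.2 (symbolKernel_nonpos _ _ _)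
  have hfs : Summable f := (summable_symbolKernel hd hα0 hα2 θ).neg
  let s : Fin d → ℤ := Pi.single i m
  let box : Finset (Fin d → ℤ) := Finset.Icc 0 fun _ => (m : ℤ)
  have hsum1 : ∑ y ∈ box, f y ≤ ∑' y, f y := hfs.sum_le_tsum _ fun _ _ => hf0 _
  have hsum2 : ∑ y ∈ box, f (y + s) ≤ ∑' y, f y := by
    rw [← (Equiv.addRight s).tsum_eq f]
    exact ((Equiv.addRight s).summable_iff.2 hfs).sum_le_tsum _ fun _ _ => hf0 _
  set A := (√d * (2 * m)) ^ ((d : ℝ) + α) with hA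
  have hA' : A = (√d * 2) ^ ((d : ℝ) + α) * ((m : ℝ) ^ d * (m : ℝ) ^ α) := by
    rw [hA, ← mul_assoc, Real.mul_rpow (by positivity) hm0.le, Real.rpow_add hm0,
      Real.rpow_natCast]
  have hA0 : 0 < A := by positivity
  have hterm : ∀ y ∈ box, (1 / 2) / A ≤ f y + f (y + s) := fun y hy => by
    obtain ⟨hy0, hym⟩ := Finset.mem_Icc.1 hy
    have hb1 : ‖latticeCoe y‖ ≤ 2 * m := by
      refine (pi_norm_le_iff_of_nonneg (by positivity)).2 fun j => ?_
      have h1 : (0 : ℝ) ≤ y j := by exact_mod_cast hy0 j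
      have h2 : (y j : ℝ) ≤ m := by exact_mod_cast hym j
      rw [Real.norm_eq_abs, latticeCoe, abs_of_nonneg h1]; linarith
    have hb2 : ‖latticeCoe (y + s)‖ ≤ 2 * m := by
      refine (pi_norm_le_iff_of_nonneg (by positivity)).2 fun j => ?_
      have h1 : (0 : ℝ) ≤ y j := by exact_mod_cast hy0 j
      have h2 : (y j : ℝ) ≤ m := by exact_mod_cast hym j
      have h3 : (0 : ℝ) ≤ s j ∧ (s j : ℝ) ≤ m := by
        by_cases hj : j = i
        · subst hj; simp [s]
        · simp [s, hj]
      rw [Real.norm_eq_abs, latticeCoe, Pi.add_apply, Int.cast_add,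
        abs_of_nonneg (by linarith)]
      linarith
    have hk1 := one_sub_cos_div_le_neg_symbolKernel hα0 θ hb1
    have hk2 := one_sub_cos_div_le_neg_symbolKernel hα0 θ hb2
    have hshift : ∑ j, θ j * latticeCoe (y + s) j = ∑ j, θ j * latticeCoe y j + θ i * m := by
      simp only [latticeCoe, Pi.add_apply, Int.cast_add, mul_add, Finset.sum_add_distrib]
      congr 1
      rw [Finset.sum_eq_single i (fun j _ hj => by simp [s, hj]) (by simp)]
      simp [s]
    have habs : |θ i * m| = m * ‖θ‖ := by rw [abs_mul, hi, abs_of_pos hm0, mul_comm]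
    have hcos := cos_add_cos_add_le (a := ∑ j, θ j * latticeCoe y j) (b := θ i * m)
      (by rwa [habs]) (by rwa [habs])
    rw [hshift] at hk2
    refine le_trans ?_ (add_le_add hk1 hk2)
    rw [← add_div]
    exact div_le_div_of_nonneg_right (by linarith) hA0.le
  have hcard : (m : ℝ) ^ d ≤ box.card := by
    have : box.card = (m + 1) ^ d := by simp [box, Pi.card_Icc]
    rw [this]; push_cast
    exact pow_le_pow_left₀ hm0.le (by linarith) d
  have hbox : (m : ℝ) ^ d * ((1 / 2) / A) ≤ ∑ y ∈ box, (f y + f (y + s)) := by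
    refine (mul_le_mul_of_nonneg_right hcard (by positivity)).trans ?_
    rw [← nsmul_eq_mul]
    exact Finset.card_nsmul_le_sum _ _ _ hterm
  rw [Finset.sum_add_distrib] at hbox
  have htsum : ∑' y, f y = -∑' y, symbolKernel α θ (latticeCoe y) := tsum_neg
  have hfin : (4 * ((√d * 2) ^ ((d : ℝ) + α) * π ^ α))⁻¹ * ‖θ‖ ^ α ≤
      (m : ℝ) ^ d * ((1 / 4) / A) := by
    have h1 : (m : ℝ) ^ α * ‖θ‖ ^ α ≤ π ^ α := by
      rw [← Real.mul_rpow hm0.le hn.le]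
      exact Real.rpow_le_rpow (by positivity) hmu hα0.le
    have h2 : (m : ℝ) ^ d * ((1 / 4) / A) = (4 * ((√d * 2) ^ ((d : ℝ) + α) * (m : ℝ) ^ α))⁻¹ := by
      rw [hA']; field_simp
    have h3 : 0 < (m : ℝ) ^ α := by positivity
    rw [h2, inv_mul_le_iff₀ (by positivity), ← div_eq_mul_inv, le_div_iff₀ (by positivity)]
    have h4 : 0 < 4 * (√d * 2) ^ ((d : ℝ) + α) := by positivity
    nlinarith
  have h2 : (m : ℝ) ^ d * ((1 / 2) / A) = 2 * ((m : ℝ) ^ d * ((1 / 4) / A)) := by ring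
  linarith

theorem tendsto_mul_latticeSymbol {d : ℕ} (hd : 1 ≤ d) {α : ℝ} (hα0 : 0 < α) (hα2 : α < 2)
    {v : Fin d → ℝ} (hv : v ≠ 0) :
    Tendsto (fun N : ℝ => N * latticeSymbol d α ((N ^ (1 / α))⁻¹ • v)) atTop
      (𝓝 (-(l2norm v ^ α * Gtilde d α))) := by
  rw [← integral_symbolKernel hd α hv]
  have hh : Tendsto (fun N : ℝ => (N ^ (1 / α))⁻¹) atTop (𝓝[>] 0) :=
    tendsto_inv_atTop_nhdsGT_zero.comp (tendsto_rpow_atTop (by positivity))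
  refine ((tendsto_integral_symbolKernel hd hα0 hα2 v).comp hh).congr' ?_
  filter_upwards [eventually_gt_atTop 0] with N hN
  have hpow : ((N ^ (1 / α))⁻¹) ^ α = N⁻¹ := by
    rw [Real.inv_rpow (by positivity), ← Real.rpow_mul hN.le, one_div_mul_cancel hα0.ne',
      Real.rpow_one]
  rw [latticeSymbol_smul hd hα0 hα2 (by positivity), hpow, ← mul_assoc, mul_inv_cancel₀ hN.ne',
    one_mul, Function.comp_apply]

/-- The cube `[-π, π]^d`. -/
def brillouinZone (d : ℕ) : Set (Fin d → ℝ) :=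
  Set.univ.pi fun _ : Fin d => Set.Icc (-Real.pi) Real.pi

theorem mem_brillouinZone_iff {d : ℕ} {θ : Fin d → ℝ} : θ ∈ brillouinZone d ↔ ‖θ‖ ≤ π := by
  simp only [brillouinZone, Set.mem_univ_pi, Set.mem_Icc,
    pi_norm_le_iff_of_nonneg Real.pi_pos.le, Real.norm_eq_abs, abs_le]

theorem measurableSet_brillouinZone (d : ℕ) : MeasurableSet (brillouinZone d) :=
  MeasurableSet.univ_pi fun _ => measurableSet_Icc

/-- The characteristic function of the walk at time `t * N`, restricted to the Brillouin zone and
rescaled by `N ^ (1 / α)`. -/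
noncomputable def scaledCharFun (d : ℕ) (α t N : ℝ) (v : Fin d → ℝ) : ℝ :=
  (brillouinZone d).indicator (fun θ => Real.exp (t * N * latticeSymbol d α θ))
    ((N ^ (1 / α))⁻¹ • v)

/-- The characteristic function of the limiting stable law. -/
noncomputable def stableCharFun (d : ℕ) (α t : ℝ) (v : Fin d → ℝ) : ℝ :=
  Real.exp (-(t * l2norm v ^ α * Gtilde d α))

theorem tendsto_scaledCharFun {d : ℕ} (hd : 1 ≤ d) {α : ℝ} (hα0 : 0 < α) (hα2 : α < 2) (t : ℝ)
    {v : Fin d → ℝ} (hv : v ≠ 0) :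
    Tendsto (fun N => scaledCharFun d α t N v) atTop (𝓝 (stableCharFun d α t v)) := by
  have h1 := ((tendsto_mul_latticeSymbol hd hα0 hα2 hv).const_mul t).rexp
  rw [show t * -(l2norm v ^ α * Gtilde d α) = -(t * l2norm v ^ α * Gtilde d α) by ring] at h1
  refine h1.congr' ?_
  filter_upwards [(tendsto_rpow_atTop (one_div_pos.2 hα0)).eventually_ge_atTop (‖v‖ / π),
    eventually_gt_atTop 0] with N hN hN0
  have hpos : 0 < N ^ (1 / α) := by positivity
  rw [scaledCharFun, Set.indicator_of_mem, mul_assoc]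
  rw [mem_brillouinZone_iff, norm_smul, Real.norm_of_nonneg (by positivity), inv_mul_le_iff₀ hpos]
  exact (div_le_iff₀ Real.pi_pos).1 hN

theorem scaledCharFun_nonneg (d : ℕ) (α t N : ℝ) (v : Fin d → ℝ) : 0 ≤ scaledCharFun d α t N v :=
  Set.indicator_nonneg (fun _ _ => (Real.exp_pos _).le) _

theorem stableCharFun_nonneg (d : ℕ) (α t : ℝ) (v : Fin d → ℝ) : 0 ≤ stableCharFun d α t v :=
  (Real.exp_pos _).le

theorem measurable_scaledCharFun {d : ℕ} (hd : 1 ≤ d) {α : ℝ} (hα0 : 0 < α) (hα2 : α < 2)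
    (t N : ℝ) : Measurable (scaledCharFun d α t N) := by
  have h := (continuous_latticeSymbol hd hα0 hα2).measurable
  exact ((h.const_mul (t * N)).exp.indicator (measurableSet_brillouinZone d)).comp
    (measurable_const_smul _)

theorem measurable_stableCharFun (d : ℕ) (α t : ℝ) : Measurable (stableCharFun d α t) := by
  have := (continuous_l2norm (d := d)).measurable
  unfold stableCharFun
  fun_prop

theorem exists_scaledCharFun_le {d : ℕ} (hd : 1 ≤ d) {α : ℝ} (hα0 : 0 < α) (hα2 : α < 2) {t : ℝ}
    (ht : 0 < t) :
    ∃ c > 0, (∀ N > 0, ∀ v, scaledCharFun d α t N v ≤ Real.exp (-c * ‖v‖ ^ α)) ∧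
      ∀ v ≠ 0, stableCharFun d α t v ≤ Real.exp (-c * ‖v‖ ^ α) := by
  obtain ⟨c, hc, hle⟩ := exists_latticeSymbol_le hd hα0 hα2
  have hbound : ∀ N > 0, ∀ v,
      scaledCharFun d α t N v ≤ Real.exp (-(t * c) * ‖v‖ ^ α) := fun N hN v => by
    refine Set.indicator_apply_le' (fun hv => ?_) fun _ => (Real.exp_pos _).le
    have h1 := hle _ (mem_brillouinZone_iff.1 hv)
    have hpow : ‖(N ^ (1 / α))⁻¹ • v‖ ^ α = N⁻¹ * ‖v‖ ^ α := by
      rw [norm_smul, Real.norm_of_nonneg (by positivity), Real.mul_rpow (by positivity)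
        (norm_nonneg v), Real.inv_rpow (by positivity), ← Real.rpow_mul hN.le,
        one_div_mul_cancel hα0.ne', Real.rpow_one]
    rw [hpow] at h1
    refine Real.exp_le_exp.2 ?_
    calc t * N * latticeSymbol d α ((N ^ (1 / α))⁻¹ • v)
        ≤ t * N * -(c * (N⁻¹ * ‖v‖ ^ α)) := mul_le_mul_of_nonneg_left h1 (by positivity)
      _ = -(t * c) * ‖v‖ ^ α := by field_simp
  refine ⟨t * c, mul_pos ht hc, hbound, fun v hv => ?_⟩
  refine le_of_tendsto (tendsto_scaledCharFun hd hα0 hα2 t hv) ?_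
  filter_upwards [eventually_gt_atTop 0] with N hN
  exact hbound N hN v

theorem ae_ne_zero {d : ℕ} (hd : 1 ≤ d) : ∀ᵐ v : Fin d → ℝ, v ≠ 0 := by
  have : Nonempty (Fin d) := ⟨⟨0, hd⟩⟩
  exact compl_mem_ae_iff.2 (measure_singleton (0 : Fin d → ℝ))

theorem integrable_scaledCharFun {d : ℕ} (hd : 1 ≤ d) {α : ℝ} (hα0 : 0 < α) (hα2 : α < 2) {t N : ℝ}
    (ht : 0 < t) (hN : 0 < N) : Integrable (scaledCharFun d α t N) := by
  obtain ⟨c, hc, hle, -⟩ := exists_scaledCharFun_le hd hα0 hα2 ht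
  refine (integrable_exp_neg_norm_rpow hd hα0 hc).mono'
    (measurable_scaledCharFun hd hα0 hα2 t N).aestronglyMeasurable (ae_of_all _ fun v => ?_)
  rw [Real.norm_of_nonneg (scaledCharFun_nonneg _ _ _ _ _)]
  exact hle N hN v

theorem integrable_stableCharFun {d : ℕ} (hd : 1 ≤ d) {α : ℝ} (hα0 : 0 < α) (hα2 : α < 2) {t : ℝ}
    (ht : 0 < t) : Integrable (stableCharFun d α t) := by
  obtain ⟨c, hc, -, hle⟩ := exists_scaledCharFun_le hd hα0 hα2 ht
  refine (integrable_exp_neg_norm_rpow hd hα0 hc).mono'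
    (measurable_stableCharFun d α t).aestronglyMeasurable ?_
  filter_upwards [ae_ne_zero hd] with v hv
  rw [Real.norm_of_nonneg (stableCharFun_nonneg _ _ _ _)]
  exact hle v hv

theorem tendsto_integral_abs_scaledCharFun_sub {d : ℕ} (hd : 1 ≤ d) {α : ℝ} (hα0 : 0 < α)
    (hα2 : α < 2) {t : ℝ} (ht : 0 < t) :
    Tendsto (fun N => ∫ v, |scaledCharFun d α t N v - stableCharFun d α t v|) atTop (𝓝 0) := by
  obtain ⟨c, hc, hle, -⟩ := exists_scaledCharFun_le hd hα0 hα2 ht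
  have hlim := tendsto_integral_filter_of_dominated_convergence (μ := volume) (l := atTop)
    (F := fun N v => |scaledCharFun d α t N v - stableCharFun d α t v|) (f := fun _ => 0)
    (fun v => Real.exp (-c * ‖v‖ ^ α) + stableCharFun d α t v)
    (Eventually.of_forall fun N => ?_) ?_
    ((integrable_exp_neg_norm_rpow hd hα0 hc).add (integrable_stableCharFun hd hα0 hα2 ht)) ?_
  · simpa using hlim
  · exact ((measurable_scaledCharFun hd hα0 hα2 t N).sub
      (measurable_stableCharFun d α t)).abs.aestronglyMeasurable
  · filter_upwards [eventually_gt_atTop 0] with N hN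
    refine ae_of_all _ fun v => ?_
    rw [norm_abs_eq_norm]
    refine (norm_sub_le _ _).trans (add_le_add ?_ ?_)
    · rw [Real.norm_of_nonneg (scaledCharFun_nonneg _ _ _ _ _)]
      exact hle N hN v
    · rw [Real.norm_of_nonneg (stableCharFun_nonneg _ _ _ _)]
  · filter_upwards [ae_ne_zero hd] with v hv
    simpa using ((tendsto_scaledCharFun hd hα0 hα2 t hv).sub_const (stableCharFun d α t v)).abs

theorem rpow_mul_pTrans_eq (d : ℕ) (α t : ℝ) {N : ℝ} (hN : 0 < N) (x : Fin d → ℤ) :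
    N ^ ((d : ℝ) / α) * pTrans d α (t * N) x = ((2 * Real.pi) ^ d)⁻¹ *
      ∫ v, scaledCharFun d α t N v * Real.cos (∑ i, v i * ((x i : ℝ) / N ^ (1 / α))) := by
  set r := N ^ (1 / α) with hr
  have hr0 : 0 < r := by positivity
  have hpow : N ^ ((d : ℝ) / α) = r ^ d := by
    rw [hr, ← Real.rpow_natCast, ← Real.rpow_mul hN.le, one_div_mul_eq_div]
  have h1 : ∀ v, scaledCharFun d α t N v * Real.cos (∑ i, v i * ((x i : ℝ) / r)) =
      (brillouinZone d).indicator (fun θ => Real.exp (t * N * latticeSymbol d α θ) *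
        Real.cos (∑ i, (x i : ℝ) * θ i)) (r⁻¹ • v) := fun v => by
    have h2 : ∑ i, v i * ((x i : ℝ) / r) = ∑ i, (x i : ℝ) * (r⁻¹ • v) i :=
      Finset.sum_congr rfl fun i _ => by simp only [Pi.smul_apply, smul_eq_mul]; ring
    rw [h2, scaledCharFun, ← hr]
    by_cases hv : r⁻¹ • v ∈ brillouinZone d <;> simp [hv]
  simp_rw [h1]
  rw [Measure.integral_comp_inv_smul_of_nonneg volume ((brillouinZone d).indicator fun θ =>
      Real.exp (t * N * latticeSymbol d α θ) * Real.cos (∑ i, (x i : ℝ) * θ i)) hr0.le,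
    integral_indicator (measurableSet_brillouinZone d), hpow, pTrans, brillouinZone]
  simp only [Module.finrank_fintype_fun_eq_card, Fintype.card_fin, smul_eq_mul]
  ring

theorem abs_integral_mul_cos_sub_le {d : ℕ} {f g φ : (Fin d → ℝ) → ℝ} (hf : Integrable f)
    (hg : Integrable g) (hφ : Continuous φ) :
    |(∫ v, f v * Real.cos (φ v)) - ∫ v, g v * Real.cos (φ v)| ≤ ∫ v, |f v - g v| := by
  have hm : AEStronglyMeasurable (fun v => Real.cos (φ v)) (volume : Measure (Fin d → ℝ)) :=
    (Real.continuous_cos.comp hφ).aestronglyMeasurable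
  have hb : ∀ᵐ v : Fin d → ℝ, ‖Real.cos (φ v)‖ ≤ 1 :=
    ae_of_all _ fun v => Real.abs_cos_le_one _
  rw [← integral_sub (hf.mul_bdd hm hb) (hg.mul_bdd hm hb), ← Real.norm_eq_abs]
  refine norm_integral_le_of_norm_le (hf.sub hg).abs (ae_of_all _ fun v => ?_)
  rw [← sub_mul, norm_mul]
  exact mul_le_of_le_one_right (norm_nonneg _) (Real.abs_cos_le_one _)

/-- **Local central limit theorem, case `0 < α < 2`** (Lemma LCLT):
`lim_{N→∞} sup_{x ∈ Z^d} |N^{d/α} p_{tN}^{d,α}(0,x) − f_t^{d,α}(x/N^{1/α})| = 0`. -/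
theorem lclt_alpha_lt_two (d : ℕ) (hd : 1 ≤ d) (α : ℝ) (hα0 : 0 < α) (hα2 : α < 2)
    (t : ℝ) (ht : 0 < t) :
    ∀ ε > 0, ∃ N₀ : ℝ, ∀ N : ℝ, N₀ ≤ N → ∀ x : Fin d → ℤ,
      |N ^ ((d : ℝ) / α) * pTrans d α (t * N) x
        - fDensity d α t (fun i => (x i : ℝ) / N ^ (1 / α))| < ε := by
  intro ε hε
  have hlim := tendsto_integral_abs_scaledCharFun_sub hd hα0 hα2 ht
  have hev := (hlim.eventually_lt_const hε).and (eventually_gt_atTop 0)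
  obtain ⟨N₀, hN₀⟩ := eventually_atTop.1 hev
  refine ⟨N₀, fun N hN x => ?_⟩
  obtain ⟨hlt, hNpos⟩ := hN₀ N hN
  have hf : fDensity d α t (fun i => (x i : ℝ) / N ^ (1 / α)) = ((2 * Real.pi) ^ d)⁻¹ *
      ∫ v, stableCharFun d α t v * Real.cos (∑ i, v i * ((x i : ℝ) / N ^ (1 / α))) := by
    simp only [fDensity, stableCharFun, mul_comm]
  rw [rpow_mul_pTrans_eq d α t hNpos, hf, ← mul_sub, abs_mul]
  have hle := abs_integral_mul_cos_sub_le (integrable_scaledCharFun hd hα0 hα2 ht hNpos)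
    (integrable_stableCharFun hd hα0 hα2 ht)
    (φ := fun v => ∑ i, v i * ((x i : ℝ) / N ^ (1 / α))) (by fun_prop)
  have hconst : |((2 * Real.pi) ^ d)⁻¹| ≤ 1 := by
    rw [abs_of_pos (by positivity)]
    exact inv_le_one_of_one_le₀ (one_le_pow₀ (by linarith [Real.pi_gt_three]))
  exact (mul_le_of_le_one_left (abs_nonneg _) hconst).trans_lt (hle.trans_lt hlt)
end

section
/- Tail estimate (equation 3.2): for every integer d ≥ 1, every real α with 0 < α < 2 and every t > 0, lim_{M→+∞} limsup_{N→+∞} ∫_{{θ ∈ R^d : M < ‖θ‖_∞ ≤ π N^{1/α}}} exp( t N · Σ_{y ∈ Z^d, y ≠ 0} (cos(θ·y / N^{1/α}) − 1)/‖y‖₂^{d+α} ) dθ = 0, where N → +∞ is taken over real N > 0. -/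
open MeasureTheory Filter Real Topology

lemma norm_le_zl2 {d : ℕ} (y : Fin d → ℤ) : ‖(fun i => (y i : ℝ))‖ ≤ zl2 y := by
  refine (pi_norm_le_iff_of_nonneg (Real.sqrt_nonneg _)).2 fun i => ?_
  rw [Real.norm_eq_abs]
  refine Real.abs_le_sqrt ?_
  exact Finset.single_le_sum (f := fun i => (y i : ℝ) ^ 2) (fun _ _ => sq_nonneg _)
    (Finset.mem_univ i)

lemma zl2_pos {d : ℕ} {y : Fin d → ℤ} (hy : y ≠ 0) : 0 < zl2 y := by
  refine lt_of_lt_of_le (norm_pos_iff.2 fun h => hy ?_) (norm_le_zl2 y)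
  funext i
  simpa using congrFun h i

lemma zl2_le_of_abs_le {d : ℕ} {y : Fin d → ℤ} {R : ℝ} (hR : 0 ≤ R)
    (hy : ∀ i, |(y i : ℝ)| ≤ R) : zl2 y ≤ d * R := by
  refine Real.sqrt_le_iff.2 ⟨by positivity, ?_⟩
  calc ∑ i, (y i : ℝ) ^ 2 ≤ ∑ _i : Fin d, R ^ 2 :=
        Finset.sum_le_sum fun i _ => sq_le_sq' (neg_le_of_abs_le (hy i)) (le_of_abs_le (hy i))
    _ = d * R ^ 2 := by simp
    _ ≤ (d * R) ^ 2 := by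
        rw [mul_pow]
        gcongr
        exact_mod_cast Nat.le_self_pow two_ne_zero d

/-- The `p`-series over `ℤ^d` with respect to the maximum norm. -/
lemma summable_intCast_norm_rpow {d : ℕ} {r : ℝ} (hr : r < -(d : ℝ)) :
    Summable fun y : Fin d → ℤ => ‖(fun i => (y i : ℝ))‖ ^ r := by
  let L := Submodule.span ℤ (Set.range (Pi.basisFun ℝ (Fin d)))
  have hrank : Module.finrank ℤ L = d := by
    rw [ZLattice.rank ℝ L]; simp
  have hs : Summable fun z : L => ‖z‖ ^ r :=
    ZLattice.summable_norm_rpow L r (by rwa [hrank])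
  have hmem (y : Fin d → ℤ) : (fun i => (y i : ℝ)) ∈ L :=
    (Module.Basis.mem_span_iff_repr_mem ℤ _ _).2 fun i => ⟨y i, by simp⟩
  refine hs.comp_injective (i := fun y => (⟨_, hmem y⟩ : L)) fun y y' h => ?_
  funext i
  simpa using congrFun (congrArg Subtype.val h) i

lemma summable_latticeSymbol {d : ℕ} {α : ℝ} (hα : 0 < α) (θ : Fin d → ℝ) :
    Summable fun y : {y : Fin d → ℤ // y ≠ 0} =>
      (1 - Real.cos (∑ i, θ i * (y.1 i : ℝ))) / zl2 y.1 ^ ((d : ℝ) + α) := by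
  have hs := ((summable_intCast_norm_rpow (d := d) (r := -((d : ℝ) + α)) (by linarith)).mul_left
    2).comp_injective (Subtype.val_injective (p := fun y : Fin d → ℤ => y ≠ 0))
  refine Summable.of_nonneg_of_le (fun y => ?_) (fun y => ?_) hs
  · exact div_nonneg (sub_nonneg.2 (Real.cos_le_one _)) (Real.rpow_nonneg (zl2_pos y.2).le _)
  · have hpos : 0 < ‖(fun i => (y.1 i : ℝ))‖ := by
      refine norm_pos_iff.2 fun h => y.2 ?_
      funext i
      simpa using congrFun h i
    simp only [Function.comp_apply]
    rw [Real.rpow_neg hpos.le, ← div_eq_mul_inv]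
    refine div_le_div₀ zero_le_two ?_ (by positivity) ?_
    · linarith [Real.neg_one_le_cos (∑ i, θ i * (y.1 i : ℝ))]
    · exact Real.rpow_le_rpow hpos.le (norm_le_zl2 _) (by positivity)

lemma half_le_of_cos_sub_nonpos {a b : ℝ} (h : Real.cos (b - a) ≤ 0) :
    1 / 2 ≤ (1 - Real.cos a) + (1 - Real.cos b) := by
  rw [Real.cos_sub] at h
  by_contra! hlt
  nlinarith [Real.sin_sq_add_cos_sq a, Real.sin_sq_add_cos_sq b,
    sq_nonneg (Real.sin a + Real.sin b)]

lemma exists_nat_mul_mem_Icc_s4 {r : ℝ} (hr : 0 < r) (hrπ : r ≤ π) :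
    ∃ n : ℕ, 1 ≤ n ∧ π / 2 ≤ n * r ∧ n * r ≤ π := by
  refine ⟨⌊π / r⌋₊, ?_, ?_, ?_⟩
  · exact Nat.le_floor (by simpa using (one_le_div hr).2 hrπ)
  · have h1 : (1 : ℝ) ≤ ⌊π / r⌋₊ := by
      exact_mod_cast Nat.le_floor (by simpa using (one_le_div hr).2 hrπ)
    have h2 := (div_lt_iff₀ hr).1 (Nat.lt_floor_add_one (π / r))
    nlinarith
  · exact (le_div_iff₀ hr).1 (Nat.floor_le (by positivity))

/-- If some multiple `n θ_j` lies in the region where the cosine is nonpositive, then comparing the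
box `{1, …, n}^d` with its translate by `n e_j` bounds the symbol by a multiple of `n^{-α}`. -/
lemma latticeSymbol_le_of_cos_nonpos {d : ℕ} {α : ℝ} (hα : 0 < α) {θ : Fin d → ℝ}
    (j : Fin d) {n : ℕ} (hn : 1 ≤ n) (hcos : Real.cos (n * θ j) ≤ 0) :
    latticeSymbol d α θ ≤ -((2 * d : ℝ) ^ (-((d : ℝ) + α)) / 4 * (n : ℝ) ^ (-α)) := by
  have : NeZero d := ⟨fun h => by subst h; exact j.elim0⟩
  have hd : (0 : ℝ) < d := by exact_mod_cast NeZero.pos d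
  have hn' : (0 : ℝ) < n := by exact_mod_cast hn
  set s : ℝ := (d : ℝ) + α with hs
  let f : {y : Fin d → ℤ // y ≠ 0} → ℝ := fun y =>
    (1 - Real.cos (∑ i, θ i * (y.1 i : ℝ))) / zl2 y.1 ^ s
  have hf : Summable f := summable_latticeSymbol hα θ
  have hf0 (y) : 0 ≤ f y :=
    div_nonneg (sub_nonneg.2 (Real.cos_le_one _)) (Real.rpow_nonneg (zl2_pos y.2).le _)
  have hsymb : latticeSymbol d α θ = -∑' y, f y := by
    rw [latticeSymbol, ← tsum_neg]
    refine tsum_congr fun y => ?_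
    simp only [f]
    ring
  let g (m : ℕ) (k : Fin d → Fin n) : {y : Fin d → ℤ // y ≠ 0} :=
    ⟨fun i => ((k i : ℕ) : ℤ) + 1 + if i = j then (m : ℤ) else 0, fun h => by
      have := congrFun h j
      simp only [if_true, Pi.zero_apply] at this
      omega⟩
  have hg (m : ℕ) : Function.Injective (g m) := fun k k' h => by
    funext i
    have := congrFun (congrArg Subtype.val h) i
    simp only [g] at this
    exact Fin.ext (by omega)
  have hsum (m : ℕ) : ∑ k, f (g m k) ≤ ∑' y, f y := by
    simpa [tsum_fintype] using tsum_comp_le_tsum_of_inj hf hf0 (hg m)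
  have hbox (m : ℕ) (hm : m ≤ n) (k) : zl2 (g m k).1 ≤ 2 * d * n := by
    have := zl2_le_of_abs_le (y := (g m k).1) (R := 2 * n) (by positivity) fun i => ?_
    · linarith
    · have hk := (k i).2
      have h1 : (g m k).1 i ≤ 2 * n := by
        simp only [g]; split_ifs <;> omega
      have h0 : 0 ≤ (g m k).1 i := by
        simp only [g]; split_ifs <;> omega
      rw [abs_of_nonneg (by exact_mod_cast h0)]
      exact_mod_cast h1
  have hterm (m : ℕ) (hm : m ≤ n) (k) :
      (1 - Real.cos (∑ i, θ i * ((g m k).1 i : ℝ))) / (2 * d * n) ^ s ≤ f (g m k) := by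
    refine div_le_div_of_nonneg_left (sub_nonneg.2 (Real.cos_le_one _))
      (Real.rpow_pos_of_pos (zl2_pos (g m k).2) _) ?_
    exact Real.rpow_le_rpow (zl2_pos (g m k).2).le (hbox m hm k) (by positivity)
  have hpair (k) : 1 / 2 / (2 * d * n) ^ s ≤ f (g 0 k) + f (g n k) := by
    refine le_trans ?_ (add_le_add (hterm 0 (Nat.zero_le _) k) (hterm n le_rfl k))
    rw [← add_div]
    refine div_le_div_of_nonneg_right (half_le_of_cos_sub_nonpos ?_) (by positivity)
    convert hcos using 2
    rw [← Finset.sum_sub_distrib, Finset.sum_eq_single j]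
    · simp [g]; ring
    · intro i _ hi
      simp [g, hi]
    · simp
  have htot : (n : ℝ) ^ d * (1 / 2 / (2 * d * n) ^ s) ≤ ∑' y, f y + ∑' y, f y := by
    calc (n : ℝ) ^ d * (1 / 2 / (2 * d * n) ^ s)
        = ∑ _k : Fin d → Fin n, (1 / 2 / (2 * d * n : ℝ) ^ s) := by simp
      _ ≤ ∑ k, (f (g 0 k) + f (g n k)) := Finset.sum_le_sum fun k _ => hpair k
      _ ≤ _ := by
        rw [Finset.sum_add_distrib]
        exact add_le_add (hsum 0) (hsum n)
  have hpow : (n : ℝ) ^ d * (1 / 2 / (2 * d * n) ^ s) =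
      2 * ((2 * d : ℝ) ^ (-s) / 4 * (n : ℝ) ^ (-α)) := by
    have hns : (n : ℝ) ^ s = (n : ℝ) ^ d * (n : ℝ) ^ α := by
      rw [hs, Real.rpow_add hn', Real.rpow_natCast]
    rw [Real.mul_rpow (by positivity) hn'.le, hns, Real.rpow_neg (by positivity),
      Real.rpow_neg hn'.le]
    field_simp
    norm_num
  rw [hsymb]
  linarith

/-- The symbol is bounded above by `-c ‖θ‖^α` on the Brillouin zone. -/
lemma exists_latticeSymbol_le_neg_mul_rpow {d : ℕ} (hd : 1 ≤ d) {α : ℝ} (hα : 0 < α) :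
    ∃ c : ℝ, 0 < c ∧ ∀ θ : Fin d → ℝ, ‖θ‖ ≤ π → latticeSymbol d α θ ≤ -(c * ‖θ‖ ^ α) := by
  have hd' : (0 : ℝ) < d := by exact_mod_cast hd
  refine ⟨(2 * d : ℝ) ^ (-((d : ℝ) + α)) / 4 * (π ^ α)⁻¹, by positivity, fun θ hθ => ?_⟩
  rcases eq_or_ne θ 0 with rfl | hne
  · simp [latticeSymbol, Real.zero_rpow hα.ne']
  have hr : 0 < ‖θ‖ := norm_pos_iff.2 hne
  obtain ⟨j, hj⟩ : ∃ j, ‖θ j‖ = ‖θ‖ := by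
    have : Nonempty (Fin d) := ⟨⟨0, hd⟩⟩
    obtain ⟨j, -, hj⟩ := Finset.exists_mem_eq_sup' Finset.univ_nonempty fun i => ‖θ i‖₊
    refine ⟨j, ?_⟩
    rw [Pi.norm_def, ← Finset.sup'_eq_sup Finset.univ_nonempty, hj, coe_nnnorm]
  obtain ⟨n, hn, h1, h2⟩ := exists_nat_mul_mem_Icc_s4 hr hθ
  have hn' : (0 : ℝ) < n := by exact_mod_cast hn
  have hcos : Real.cos (n * θ j) ≤ 0 := by
    rw [← Real.cos_abs, abs_mul, Nat.abs_cast, ← Real.norm_eq_abs, hj]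
    exact Real.cos_nonpos_of_pi_div_two_le_of_le h1 (by linarith [Real.pi_pos])
  refine (latticeSymbol_le_of_cos_nonpos hα j hn hcos).trans (neg_le_neg ?_)
  rw [mul_assoc]
  refine mul_le_mul_of_nonneg_left ?_ (by positivity)
  rw [inv_mul_eq_div, ← Real.div_rpow hr.le Real.pi_pos.le, Real.rpow_neg hn'.le,
    ← Real.inv_rpow hn'.le]
  refine Real.rpow_le_rpow (by positivity) ?_ hα.le
  rw [div_le_iff₀ Real.pi_pos, inv_mul_eq_div, le_div_iff₀ hn']
  linarith

lemma integrable_exp_neg_mul_norm_rpow {E : Type*} [NormedAddCommGroup E] [NormedSpace ℝ E]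
    [FiniteDimensional ℝ E] [Nontrivial E] [MeasurableSpace E] [BorelSpace E] (μ : Measure E)
    [μ.IsAddHaarMeasure] {b p : ℝ} (hb : 0 < b) (hp : 0 < p) :
    Integrable (fun x : E => Real.exp (-b * ‖x‖ ^ p)) μ := by
  refine (integrable_fun_norm_addHaar μ (f := fun r : ℝ => Real.exp (-b * r ^ p))).2 ?_
  have := integrableOn_rpow_mul_exp_neg_mul_rpow (s := ((Module.finrank ℝ E - 1 : ℕ) : ℝ))
    (lt_of_lt_of_le neg_one_lt_zero (Nat.cast_nonneg _)) hp hb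
  simpa only [Real.rpow_natCast, smul_eq_mul] using this

lemma tendsto_setIntegral_norm_gt {E : Type*} [NormedAddCommGroup E] [MeasurableSpace E]
    [OpensMeasurableSpace E] {μ : Measure E} {f : E → ℝ} (hf : Integrable f μ) :
    Tendsto (fun M : ℝ => ∫ x in {x | M < ‖x‖}, f x ∂μ) atTop (𝓝 0) := by
  have hmeas (M : ℝ) : MeasurableSet {x : E | M < ‖x‖} :=
    measurableSet_lt measurable_const measurable_norm
  simp_rw [← integral_indicator (hmeas _)]
  rw [← integral_zero E ℝ (μ := μ)]
  refine tendsto_integral_filter_of_dominated_convergence (fun x => ‖f x‖)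
    (.of_forall fun M => hf.aestronglyMeasurable.indicator (hmeas M))
    (.of_forall fun M => .of_forall fun x => norm_indicator_le_norm_self f x) hf.norm
    (.of_forall fun x => tendsto_const_nhds.congr' ?_)
  filter_upwards [eventually_ge_atTop ‖x‖] with M hM
  simp [hM]

/-- **Tail estimate (equation 3.2)**: for `0 < α < 2` and `t > 0`,
`lim_{M→∞} limsup_{N→∞} ∫_{M < ‖θ‖_∞ ≤ πN^{1/α}} exp(tN Σ_{y≠0}(cos(θ·y/N^{1/α})−1)/‖y‖₂^{d+α}) dθ = 0`.
Here `‖θ‖` is the sup (l∞) norm on `Fin d → ℝ`. -/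
theorem tail_estimate_alpha_lt_two (d : ℕ) (hd : 1 ≤ d) (α : ℝ) (hα0 : 0 < α) (hα2 : α < 2)
    (t : ℝ) (ht : 0 < t) :
    Tendsto
      (fun M : ℝ =>
        Filter.limsup
          (fun N : ℝ =>
            ∫ θ in {θ : Fin d → ℝ | M < ‖θ‖ ∧ ‖θ‖ ≤ Real.pi * N ^ (1 / α)},
              Real.exp (t * N * latticeSymbol d α (fun i => θ i / N ^ (1 / α))))
          atTop)
      atTop (𝓝 0) := by
  obtain ⟨c, hc, hbound⟩ := exists_latticeSymbol_le_neg_mul_rpow hd hα0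
  have : Nonempty (Fin d) := ⟨⟨0, hd⟩⟩
  have hint : Integrable (fun θ : Fin d → ℝ => Real.exp (-(t * c) * ‖θ‖ ^ α)) :=
    integrable_exp_neg_mul_norm_rpow volume (mul_pos ht hc) hα0
  have hnonneg (M N : ℝ) : 0 ≤ ∫ θ in {θ : Fin d → ℝ | M < ‖θ‖ ∧ ‖θ‖ ≤ Real.pi * N ^ (1 / α)},
      Real.exp (t * N * latticeSymbol d α (fun i => θ i / N ^ (1 / α))) :=
    integral_nonneg fun _ => (Real.exp_pos _).le
  have hle (M N : ℝ) (hN : 0 < N) :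
      ∫ θ in {θ : Fin d → ℝ | M < ‖θ‖ ∧ ‖θ‖ ≤ Real.pi * N ^ (1 / α)},
        Real.exp (t * N * latticeSymbol d α (fun i => θ i / N ^ (1 / α))) ≤
      ∫ θ in {θ : Fin d → ℝ | M < ‖θ‖}, Real.exp (-(t * c) * ‖θ‖ ^ α) := by
    have hmeas : MeasurableSet {θ : Fin d → ℝ | M < ‖θ‖ ∧ ‖θ‖ ≤ Real.pi * N ^ (1 / α)} :=
      (measurableSet_lt measurable_const measurable_norm).inter
        (measurableSet_le measurable_norm measurable_const)
    refine le_trans (integral_mono_of_nonneg (.of_forall fun _ => (Real.exp_pos _).le)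
      hint.integrableOn ?_) (setIntegral_mono_set hint.integrableOn
        (.of_forall fun _ => (Real.exp_pos _).le) (.of_forall fun θ hθ => hθ.1))
    refine (ae_restrict_iff' hmeas).2 (.of_forall fun θ hθ => Real.exp_le_exp.2 ?_)
    have hK : 0 < N ^ (1 / α) := Real.rpow_pos_of_pos hN _
    have hscale : (fun i => θ i / N ^ (1 / α)) = (N ^ (1 / α))⁻¹ • θ := by
      funext i
      simp [div_eq_inv_mul]
    have hnorm : ‖(N ^ (1 / α))⁻¹ • θ‖ = ‖θ‖ / N ^ (1 / α) := by
      rw [norm_smul, Real.norm_of_nonneg (by positivity), div_eq_inv_mul ‖θ‖]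
    have hKα : (N ^ (1 / α)) ^ α = N := by
      rw [← Real.rpow_mul hN.le, one_div_mul_cancel hα0.ne', Real.rpow_one]
    have h := hbound ((N ^ (1 / α))⁻¹ • θ) (by rw [hnorm, div_le_iff₀ hK]; exact hθ.2)
    rw [hnorm, Real.div_rpow (norm_nonneg _) hK.le, hKα] at h
    rw [hscale]
    calc t * N * latticeSymbol d α ((N ^ (1 / α))⁻¹ • θ)
        ≤ t * N * -(c * (‖θ‖ ^ α / N)) := mul_le_mul_of_nonneg_left h (by positivity)
      _ = -(t * c) * ‖θ‖ ^ α := by field_simp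
  refine tendsto_of_tendsto_of_tendsto_of_le_of_le tendsto_const_nhds
    (tendsto_setIntegral_norm_gt hint) (fun M => ?_) (fun M => ?_)
  · refine le_limsup_of_frequently_le (Eventually.of_forall (hnonneg M)).frequently ?_
    exact ⟨_, (eventually_gt_atTop 0).mono (hle M)⟩
  · refine limsup_le_of_le ?_ ((eventually_gt_atTop 0).mono (hle M))
    exact IsCoboundedUnder.of_frequently_ge (Eventually.of_forall (hnonneg M)).frequently
end

section
/- Logarithmic lower bound for the symbol in the critical case α = 2: for every integer d ≥ 1 there exist a constant c > 0 and s₀ ∈ (0,1) such that for every s ∈ (0, s₀] and every ϖ ∈ R^d with ‖ϖ‖_∞ = 1, Σ_{y ∈ Z^d, y ≠ 0} (1 − cos( s · (ϖ·y) )) / ‖y‖₂^{d+2} ≥ c · s² · log(1/s). -/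
open MeasureTheory Filter Real Topology

/-- The lattice sum `∑ ‖y‖₂^(-r)` over `ℤ^d` converges for `r > d`. -/
theorem summable_inv_zl2_rpow (d : ℕ) {r : ℝ} (hr : (d : ℝ) < r) :
    Summable fun y : Fin d → ℤ => (zl2 y ^ r)⁻¹ := by
  let b := (EuclideanSpace.basisFun (Fin d) ℝ).toBasis
  let L : Submodule ℤ (EuclideanSpace ℝ (Fin d)) := Submodule.span ℤ (Set.range b)
  have hrank : Module.finrank ℤ L = d := by
    rw [ZLattice.rank ℝ L]
    simp
  have hmem (y : Fin d → ℤ) : ∑ i, y i • b i ∈ L :=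
    Submodule.sum_mem _ fun i _ => Submodule.smul_mem _ _ (Submodule.subset_span ⟨i, rfl⟩)
  have hcoord (y : Fin d → ℤ) (j : Fin d) : (∑ i, y i • b i) j = (y j : ℝ) := by
    simp [b, Finset.sum_apply, Pi.single_apply]
  let e : (Fin d → ℤ) → L := fun y => ⟨∑ i, y i • b i, hmem y⟩
  have he : Function.Injective e := by
    intro x y hxy
    funext j
    have h := congrArg (fun z : L => (z : EuclideanSpace ℝ (Fin d)) j) hxy
    simp only [e, hcoord] at h
    exact_mod_cast h
  have hnorm (y : Fin d → ℤ) : ‖e y‖ = zl2 y := by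
    change ‖∑ i, y i • b i‖ = _
    rw [EuclideanSpace.norm_eq]
    simp only [hcoord, zl2, l2norm, Real.norm_eq_abs, sq_abs]
  have h := (ZLattice.summable_norm_rpow L (-r) (by rw [hrank]; linarith)).comp_injective he
  refine h.congr fun y => ?_
  rw [Function.comp_apply, hnorm, Real.rpow_neg]
  exact Real.sqrt_nonneg _

/-- The lattice points `y` with `|y i₀| = n`, all `|y j| ≤ n`, and each `y j` of the sign of
`ϖ j`. -/
noncomputable def signedShell {d : ℕ} (ϖ : Fin d → ℝ) (i₀ : Fin d) (n : ℕ) :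
    Finset (Fin d → ℤ) :=
  Fintype.piFinset fun j =>
    if j = i₀ then (if 0 ≤ ϖ j then {(n : ℤ)} else {-(n : ℤ)})
    else (if 0 ≤ ϖ j then Finset.Icc 0 (n : ℤ) else Finset.Icc (-(n : ℤ)) 0)

section signedShell

variable {d : ℕ} {ϖ : Fin d → ℝ} {i₀ : Fin d} {n : ℕ} {y : Fin d → ℤ}

theorem card_signedShell (ϖ : Fin d → ℝ) (i₀ : Fin d) (n : ℕ) :
    (signedShell ϖ i₀ n).card = (n + 1) ^ (d - 1) := by
  rw [signedShell, Fintype.card_piFinset, ← Finset.mul_prod_erase _ _ (Finset.mem_univ i₀)]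
  have h₀ : (if i₀ = i₀ then (if 0 ≤ ϖ i₀ then {(n : ℤ)} else {-(n : ℤ)})
      else (if 0 ≤ ϖ i₀ then Finset.Icc 0 (n : ℤ) else Finset.Icc (-(n : ℤ)) 0)).card = 1 := by
    split_ifs <;> simp_all
  rw [h₀, one_mul, Finset.prod_congr rfl (g := fun _ => n + 1), Finset.prod_const,
    Finset.card_erase_of_mem (Finset.mem_univ _), Finset.card_univ, Fintype.card_fin]
  intro j hj
  rw [if_neg (Finset.ne_of_mem_erase hj)]
  split_ifs
  · simp
  · simp only [Int.card_Icc]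
    omega

theorem abs_apply_of_mem_signedShell (hy : y ∈ signedShell ϖ i₀ n) : |y i₀| = n := by
  have h := Fintype.mem_piFinset.1 hy i₀
  simp only [if_true] at h
  split_ifs at h <;> simp_all

theorem abs_le_of_mem_signedShell (hy : y ∈ signedShell ϖ i₀ n) (j : Fin d) : |y j| ≤ n := by
  have h := Fintype.mem_piFinset.1 hy j
  rw [abs_le]
  split_ifs at h <;> simp only [Finset.mem_singleton, Finset.mem_Icc] at h <;> omega

theorem mul_eq_abs_of_mem_signedShell (hy : y ∈ signedShell ϖ i₀ n) (j : Fin d) :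
    ϖ j * (y j : ℝ) = |ϖ j| * |(y j : ℝ)| := by
  have h := Fintype.mem_piFinset.1 hy j
  by_cases hp : 0 ≤ ϖ j
  · have : 0 ≤ y j := by
      simp only [hp, if_true] at h
      split_ifs at h <;> simp only [Finset.mem_singleton, Finset.mem_Icc] at h <;> omega
    rw [abs_of_nonneg hp, abs_of_nonneg (by exact_mod_cast this)]
  · have : y j ≤ 0 := by
      simp only [hp, if_false] at h
      split_ifs at h <;> simp only [Finset.mem_singleton, Finset.mem_Icc] at h <;> omega
    rw [abs_of_neg (not_le.1 hp), abs_of_nonpos (by exact_mod_cast this)]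
    ring

theorem le_sum_mul_of_mem_signedShell (hi : |ϖ i₀| = 1) (hy : y ∈ signedShell ϖ i₀ n) :
    (n : ℝ) ≤ ∑ i, ϖ i * (y i : ℝ) := by
  have h₀ : ϖ i₀ * (y i₀ : ℝ) = n := by
    rw [mul_eq_abs_of_mem_signedShell hy, hi, one_mul]
    exact_mod_cast abs_apply_of_mem_signedShell hy
  rw [← h₀]
  refine Finset.single_le_sum (f := fun i => ϖ i * (y i : ℝ)) (fun j _ => ?_)
    (Finset.mem_univ i₀)
  rw [mul_eq_abs_of_mem_signedShell hy]
  positivity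

theorem sum_mul_le_of_mem_signedShell (hϖ : ∀ i, |ϖ i| ≤ 1) (hy : y ∈ signedShell ϖ i₀ n) :
    ∑ i, ϖ i * (y i : ℝ) ≤ d * n := by
  have h : ∑ i, ϖ i * (y i : ℝ) ≤ ∑ _i : Fin d, (n : ℝ) := by
    refine Finset.sum_le_sum fun j _ => ?_
    rw [mul_eq_abs_of_mem_signedShell hy]
    have hj : |(y j : ℝ)| ≤ n := by exact_mod_cast abs_le_of_mem_signedShell hy j
    calc |ϖ j| * |(y j : ℝ)| ≤ 1 * n := by gcongr; exact hϖ j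
      _ = n := one_mul _
  simpa using h

theorem zl2_le_of_mem_signedShell (hy : y ∈ signedShell ϖ i₀ n) : zl2 y ≤ d * n := by
  have hd : (1 : ℝ) ≤ d := by exact_mod_cast i₀.pos
  refine Real.sqrt_le_iff.2 ⟨by positivity, ?_⟩
  calc ∑ i, (y i : ℝ) ^ 2 ≤ ∑ _i : Fin d, (n : ℝ) ^ 2 := by
        refine Finset.sum_le_sum fun j _ => sq_le_sq.2 ?_
        rw [Nat.abs_cast]
        exact_mod_cast abs_le_of_mem_signedShell hy j
    _ = d * (n : ℝ) ^ 2 := by simp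
    _ ≤ (d * n) ^ 2 := by nlinarith [sq_nonneg (n : ℝ)]

theorem zl2_pos_of_mem_signedShell (hn : n ≠ 0) (hy : y ∈ signedShell ϖ i₀ n) : 0 < zl2 y := by
  refine Real.sqrt_pos.2 ((sq_pos_of_ne_zero ?_).trans_le
    (Finset.single_le_sum (f := fun i => (y i : ℝ) ^ 2) (fun _ _ => sq_nonneg _)
      (Finset.mem_univ i₀)))
  have h := abs_apply_of_mem_signedShell hy
  intro h0
  rw [Int.cast_eq_zero.1 h0] at h
  simp at h
  omega

theorem disjoint_signedShell {m : ℕ} (h : m ≠ n) :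
    Disjoint (signedShell ϖ i₀ m) (signedShell ϖ i₀ n) := by
  refine Finset.disjoint_left.2 fun y hm hn => h ?_
  have := (abs_apply_of_mem_signedShell hm).symm.trans (abs_apply_of_mem_signedShell hn)
  exact_mod_cast this

/-- Each point of a shell of small radius contributes at least a multiple of
`s² n² / n^(d+2)`. -/
theorem le_term_of_mem_signedShell (hϖ : ∀ i, |ϖ i| ≤ 1) (hi : |ϖ i₀| = 1) (hn : n ≠ 0)
    {s : ℝ} (hs : 0 ≤ s) (hsn : s * (d * n) ≤ π) (hy : y ∈ signedShell ϖ i₀ n) :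
    2 / π ^ 2 * (s * n) ^ 2 / (d * n : ℝ) ^ (d + 2) ≤
      (1 - Real.cos (s * ∑ i, ϖ i * (y i : ℝ))) / zl2 y ^ ((d : ℝ) + 2) := by
  have hlow := le_sum_mul_of_mem_signedShell hi hy
  have hup := sum_mul_le_of_mem_signedShell hϖ hy
  have hsum : 0 ≤ s * ∑ i, ϖ i * (y i : ℝ) := mul_nonneg hs ((Nat.cast_nonneg n).trans hlow)
  have hcos : Real.cos (s * ∑ i, ϖ i * (y i : ℝ)) ≤
      1 - 2 / π ^ 2 * (s * ∑ i, ϖ i * (y i : ℝ)) ^ 2 := by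
    apply Real.cos_le_one_sub_mul_cos_sq
    rw [abs_of_nonneg hsum]
    exact (mul_le_mul_of_nonneg_left hup hs).trans hsn
  have hpow : zl2 y ^ ((d : ℝ) + 2) = zl2 y ^ (d + 2) := by
    rw [← Real.rpow_natCast]
    push_cast
    rfl
  have hz := zl2_pos_of_mem_signedShell hn hy
  rw [hpow]
  refine div_le_div₀ (by linarith [Real.cos_le_one (s * ∑ i, ϖ i * (y i : ℝ))]) ?_
    (by positivity) (pow_le_pow_left₀ hz.le (zl2_le_of_mem_signedShell hy) _)
  have : 2 / π ^ 2 * (s * n) ^ 2 ≤ 2 / π ^ 2 * (s * ∑ i, ϖ i * (y i : ℝ)) ^ 2 := by gcongr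
  linarith

/-- The total contribution of a shell of small radius `n` is at least a multiple of `s² / n`. -/
theorem le_sum_signedShell (hϖ : ∀ i, |ϖ i| ≤ 1) (hi : |ϖ i₀| = 1) (hn : n ≠ 0)
    {s : ℝ} (hs : 0 ≤ s) (hsn : s * (d * n) ≤ π) :
    2 / π ^ 2 / (d : ℝ) ^ (d + 2) * s ^ 2 * (n : ℝ)⁻¹ ≤
      ∑ y ∈ signedShell ϖ i₀ n,
        (1 - Real.cos (s * ∑ i, ϖ i * (y i : ℝ))) / zl2 y ^ ((d : ℝ) + 2) := by
  refine le_trans ?_ (Finset.card_nsmul_le_sum _ _ _ fun y hy =>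
    le_term_of_mem_signedShell hϖ hi hn hs hsn hy)
  rw [card_signedShell, nsmul_eq_mul]
  have hd : (0 : ℝ) < d := by exact_mod_cast i₀.pos
  have hn' : (0 : ℝ) < n := by exact_mod_cast Nat.pos_of_ne_zero hn
  obtain ⟨k, hk⟩ : ∃ k, d = k + 1 := ⟨d - 1, by have := i₀.pos; omega⟩
  have hcard : (n : ℝ) ^ (d - 1) ≤ (((n + 1) ^ (d - 1) : ℕ) : ℝ) := by
    push_cast
    gcongr
    linarith
  refine le_trans (le_of_eq ?_) (mul_le_mul_of_nonneg_right hcard (by positivity))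
  have hnp : (n : ℝ) ^ (d + 2) = n ^ (d - 1) * n ^ 3 := by
    rw [← pow_add]
    congr 1
    omega
  rw [mul_pow (d : ℝ), hnp]
  field_simp

end signedShell

/-- **Logarithmic lower bound for the symbol in the critical case `α = 2`**: there exist
`c > 0` and `s₀ ∈ (0,1)` such that for all `s ∈ (0, s₀]` and all `ϖ` with `‖ϖ‖_∞ = 1`,
`Σ_{y≠0} (1 − cos(s(ϖ·y)))/‖y‖₂^{d+2} ≥ c s² log(1/s)`.
Here `‖ϖ‖` is the sup (l∞) norm on `Fin d → ℝ`. -/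
theorem symbol_log_lower_bound (d : ℕ) (hd : 1 ≤ d) :
    ∃ c : ℝ, 0 < c ∧ ∃ s₀ : ℝ, s₀ ∈ Set.Ioo (0 : ℝ) 1 ∧
      ∀ s ∈ Set.Ioc (0 : ℝ) s₀, ∀ ϖ : Fin d → ℝ, ‖ϖ‖ = 1 →
        c * s ^ 2 * Real.log (1 / s) ≤
          ∑' y : {y : Fin d → ℤ // y ≠ 0},
            (1 - Real.cos (s * ∑ i, ϖ i * (y.1 i : ℝ))) / zl2 y.1 ^ ((d : ℝ) + 2) := by
  have hd' : (1 : ℝ) ≤ d := by exact_mod_cast hd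
  set c : ℝ := 2 / π ^ 2 / (d : ℝ) ^ (d + 2) with hc
  have hc0 : 0 < c := by positivity
  refine ⟨c / 2, by positivity, ((d : ℝ) ^ 2 + 1)⁻¹,
    ⟨by positivity, inv_lt_one_of_one_lt₀ (by nlinarith)⟩, ?_⟩
  rintro s ⟨hs, hs₀⟩ ϖ hϖ
  have : Nonempty (Fin d) := ⟨⟨0, hd⟩⟩
  have hle (i : Fin d) : |ϖ i| ≤ 1 := hϖ ▸ norm_le_pi_norm ϖ i
  obtain ⟨i₀, hi⟩ : ∃ i₀, |ϖ i₀| = 1 := by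
    obtain ⟨i, hi⟩ := Finite.exists_max fun i => ‖ϖ i‖
    refine ⟨i, le_antisymm (hle i) ?_⟩
    rw [← hϖ]
    exact (pi_norm_le_iff_of_nonempty ϖ).2 hi
  set f : (Fin d → ℤ) → ℝ := fun y =>
    (1 - Real.cos (s * ∑ i, ϖ i * (y i : ℝ))) / zl2 y ^ ((d : ℝ) + 2) with hf
  have hf0 (y : Fin d → ℤ) : 0 ≤ f y :=
    div_nonneg (sub_nonneg.2 (Real.cos_le_one _)) (Real.rpow_nonneg (Real.sqrt_nonneg _) _)
  have hsummable : Summable f := by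
    refine .of_nonneg_of_le hf0 (fun y => ?_)
      ((summable_inv_zl2_rpow d (r := (d : ℝ) + 2) (by linarith)).mul_left 2)
    simp only [hf, div_eq_mul_inv]
    refine mul_le_mul_of_nonneg_right ?_
      (inv_nonneg.2 (Real.rpow_nonneg (Real.sqrt_nonneg _) _))
    linarith [Real.neg_one_le_cos (s * ∑ i, ϖ i * (y i : ℝ))]
  have htsum : ∑' y : {y : Fin d → ℤ // y ≠ 0}, f y.1 = ∑' y, f y := by
    refine tsum_subtype_eq_of_support_subset (s := {y : Fin d → ℤ | y ≠ 0}) fun y hy h0 => hy ?_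
    simp [hf, h0]
  change _ ≤ ∑' y : {y : Fin d → ℤ // y ≠ 0}, f y.1
  rw [htsum]
  set N : ℕ := ⌊(s * d)⁻¹⌋₊ with hN
  have hlog : Real.log (1 / s) / 2 ≤ ∑ n ∈ Finset.Icc 1 N, (n : ℝ)⁻¹ := by
    have h₁ : Real.log (s * d)⁻¹ ≤ ∑ n ∈ Finset.Icc 1 N, (n : ℝ)⁻¹ := by
      have h := log_le_harmonic_floor (s * d)⁻¹ (by positivity)
      rw [harmonic_eq_sum_Icc] at h
      push_cast at h
      exact h
    have h₂ : 2 * Real.log d ≤ Real.log (1 / s) := by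
      have h : (d : ℝ) ^ 2 ≤ 1 / s := by
        rw [one_div]
        exact (by linarith : (d : ℝ) ^ 2 ≤ d ^ 2 + 1).trans
          ((le_inv_comm₀ hs (by positivity)).1 hs₀)
      have := Real.log_le_log (by positivity) h
      rwa [Real.log_pow, Nat.cast_ofNat] at this
    rw [Real.log_inv, Real.log_mul hs.ne' (by positivity)] at h₁
    rw [one_div, Real.log_inv] at h₂ ⊢
    linarith
  calc c / 2 * s ^ 2 * Real.log (1 / s) = c * s ^ 2 * (Real.log (1 / s) / 2) := by ring
    _ ≤ c * s ^ 2 * ∑ n ∈ Finset.Icc 1 N, (n : ℝ)⁻¹ := by gcongr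
    _ = ∑ n ∈ Finset.Icc 1 N, c * s ^ 2 * (n : ℝ)⁻¹ := Finset.mul_sum _ _ _
    _ ≤ ∑ n ∈ Finset.Icc 1 N, ∑ y ∈ signedShell ϖ i₀ n, f y := by
      refine Finset.sum_le_sum fun n hn => ?_
      rw [Finset.mem_Icc] at hn
      refine le_sum_signedShell hle hi (by omega) hs.le ?_
      have hnN : (n : ℝ) ≤ (s * d)⁻¹ := (Nat.le_floor_iff (by positivity)).1 hn.2
      calc s * (d * n) = s * d * n := by ring
        _ ≤ s * d * (s * d)⁻¹ := by gcongr
        _ = 1 := mul_inv_cancel₀ (by positivity)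
        _ ≤ π := by linarith [Real.pi_gt_three]
    _ = ∑ y ∈ (Finset.Icc 1 N).biUnion (signedShell ϖ i₀), f y :=
      (Finset.sum_biUnion fun _ _ _ _ h => disjoint_signedShell h).symm
    _ ≤ ∑' y, f y := hsummable.sum_le_tsum _ fun y _ => hf0 y
end
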